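/- There exist universal constants C, c > 0 such that for every γ ≥ 1 there exists a model class M ⊆ M⁺ (over a suitable decision and observation space) with the following two properties: for all ε ∈ (0,1), sup_{M̄∈co(M)} dec^c_ε(M ∪ {M̄}, M̄) ≤ C·ε²·γ^{1/2} (so in particular this quantity is at most C·ε whenever ε ≤ γ^{−1/2}); yet there exists M̄ ∈ M such that dec^o_γ(M, M̄) ≥ c·γ^{−1/2}. -/

import Mathlib

open MeasureTheory ProbabilityTheory
open scoped ENNReal NNReal

noncomputable section

/-- The squared Hellinger distance between two measures, computed with respect to the
common dominating measure `P + Q`. -/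
def sqHellinger {Z : Type} [MeasurableSpace Z] (P Q : Measure Z) : ℝ :=
  ∫ z, (Real.sqrt ((P.rnDeriv (P + Q)) z).toReal
      - Real.sqrt ((Q.rnDeriv (P + Q)) z).toReal) ^ 2 ∂(P + Q)

/-- A model: a Markov kernel from decisions to distributions over reward/observation pairs,
with rewards supported in `[0,1]`, together with a maximizing decision
(whose existence is assumed). -/
structure Model (X Y : Type) [MeasurableSpace X] [MeasurableSpace Y] where
  k : Kernel X (ℝ × Y)
  markov : IsMarkovKernel k
  reward01 : ∀ x : X, (k x) {ry : ℝ × Y | ry.1 ∈ Set.Icc (0 : ℝ) 1}ᶜ = 0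
  opt : X
  opt_max : ∀ x : X, (∫ ry, ry.1 ∂(k x)) ≤ ∫ ry, ry.1 ∂(k opt)

variable {X Y : Type} [MeasurableSpace X] [MeasurableSpace Y]

/-- Mean reward `f^M(x)`. -/
def fm (M : Model X Y) (x : X) : ℝ := ∫ ry, ry.1 ∂(M.k x)

/-- Suboptimality gap `g^M(x) = f^M(π_M) - f^M(x)`. -/
def gap (M : Model X Y) (x : X) : ℝ := fm M M.opt - fm M x

/-- Expected suboptimality of a decision distribution `p` under model `M`. -/
def avgGap (p : ProbabilityMeasure X) (M : Model X Y) : ℝ :=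
  ∫ x, gap M x ∂(p : Measure X)

/-- Expected squared Hellinger distance between `M` and `Mbar` under `p`. -/
def avgHell (p : ProbabilityMeasure X) (M Mbar : Model X Y) : ℝ :=
  ∫ x, sqHellinger (M.k x) (Mbar.k x) ∂(p : Measure X)

/-- The constrained regret Decision-Estimation Coefficient. -/
def decC (ε : ℝ) (𝓜 : Set (Model X Y)) (Mbar : Model X Y) : ℝ :=
  ⨅ p : ProbabilityMeasure X,
    ⨆ M ∈ {M ∈ 𝓜 | avgHell p M Mbar ≤ ε ^ 2}, avgGap p M

/-- The offset regret Decision-Estimation Coefficient. -/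
def decO (γ : ℝ) (𝓜 : Set (Model X Y)) (Mbar : Model X Y) : ℝ :=
  ⨅ p : ProbabilityMeasure X, ⨆ M ∈ 𝓜, (avgGap p M - γ * avgHell p M Mbar)

/-- The constrained PAC Decision-Estimation Coefficient. -/
def decCpac (ε : ℝ) (𝓜 : Set (Model X Y)) (Mbar : Model X Y) : ℝ :=
  ⨅ p : ProbabilityMeasure X, ⨅ q : ProbabilityMeasure X,
    ⨆ M ∈ {M ∈ 𝓜 | avgHell q M Mbar ≤ ε ^ 2}, avgGap p M

/-- The offset PAC Decision-Estimation Coefficient. -/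
def decOpac (γ : ℝ) (𝓜 : Set (Model X Y)) (Mbar : Model X Y) : ℝ :=
  ⨅ p : ProbabilityMeasure X, ⨅ q : ProbabilityMeasure X,
    ⨆ M ∈ 𝓜, (avgGap p M - γ * avgHell q M Mbar)

/-- A distribution over a class of models, represented as a probability space together with
a (measurable) family of models belonging to the class. -/
structure ClassDist (X Y : Type) [MeasurableSpace X] [MeasurableSpace Y]
    (𝓜 : Set (Model X Y)) where
  (Ω : Type)
  [iΩ : MeasurableSpace Ω]
  (ν : Measure Ω)
  (prob : IsProbabilityMeasure ν)
  (m : Ω → Model X Y)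
  (mem : ∀ ω, m ω ∈ 𝓜)
  (meas : ∀ (x : X) (A : Set (ℝ × Y)), MeasurableSet A → Measurable fun ω => (m ω).k x A)

attribute [instance] ClassDist.iΩ

/-- `Mbar` is the mixture (mean) model of the class distribution `D`. -/
def IsMixtureOf {𝓜 : Set (Model X Y)} (D : ClassDist X Y 𝓜) (Mbar : Model X Y) : Prop :=
  ∀ (x : X) (A : Set (ℝ × Y)), MeasurableSet A →
    Mbar.k x A = ∫⁻ ω, (D.m ω).k x A ∂D.ν

/-- The convex hull of a model class: all mixtures of models in the class. -/
def convHull (𝓜 : Set (Model X Y)) : Set (Model X Y) :=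
  {Mbar | ∃ D : ClassDist X Y 𝓜, IsMixtureOf D Mbar}

/-- `dec^c_ε(𝓜) = sup_{Mbar ∈ co(𝓜)} dec^c_ε(𝓜 ∪ {Mbar}, Mbar)`. -/
def decCfull (ε : ℝ) (𝓜 : Set (Model X Y)) : ℝ :=
  ⨆ Mbar ∈ convHull 𝓜, decC ε (𝓜 ∪ {Mbar}) Mbar

/-- `dec^{c,pac}_ε(𝓜) = sup_{Mbar ∈ co(𝓜)} dec^{c,pac}_ε(𝓜, Mbar)`. -/
def decCpacFull (ε : ℝ) (𝓜 : Set (Model X Y)) : ℝ :=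
  ⨆ Mbar ∈ convHull 𝓜, decCpac ε 𝓜 Mbar

/-- The localized subclass `𝓜_α(Mbar)`. -/
def locClass (α : ℝ) (𝓜 : Set (Model X Y)) (Mbar : Model X Y) : Set (Model X Y) :=
  {M ∈ 𝓜 | fm M M.opt ≤ fm Mbar Mbar.opt + α}

/-- The greedy PAC Decision-Estimation Coefficient. -/
def decGpac (ε : ℝ) (𝓜 : Set (Model X Y)) (Mbar : Model X Y) : ℝ :=
  ⨅ q : ProbabilityMeasure X,
    ⨆ M ∈ {M ∈ 𝓜 | avgHell q M Mbar ≤ ε ^ 2}, (fm M M.opt - fm M Mbar.opt)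

/-- The PAC DEC with Hellinger constraints under both `p` and `q`. -/
def decAlt (ε : ℝ) (𝓜 : Set (Model X Y)) (Mbar : Model X Y) : ℝ :=
  ⨅ p : ProbabilityMeasure X, ⨅ q : ProbabilityMeasure X,
    ⨆ M ∈ {M ∈ 𝓜 | avgHell p M Mbar ≤ ε ^ 2 ∧ avgHell q M Mbar ≤ ε ^ 2}, avgGap p M

/-- Expected squared Hellinger distance to a randomized reference model. -/
def randAvgHell {𝓜 : Set (Model X Y)} (p : ProbabilityMeasure X) (M : Model X Y)
    (D : ClassDist X Y 𝓜) : ℝ :=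
  ∫ ω, avgHell p M (D.m ω) ∂D.ν

/-- The randomized offset regret DEC. -/
def decOrand (γ : ℝ) {𝓜₀ : Set (Model X Y)} (𝓜 : Set (Model X Y))
    (D : ClassDist X Y 𝓜₀) : ℝ :=
  ⨅ p : ProbabilityMeasure X, ⨆ M ∈ 𝓜, (avgGap p M - γ * randAvgHell p M D)

/-- The randomized constrained regret DEC. -/
def decCrand (ε : ℝ) {𝓜₀ : Set (Model X Y)} (𝓜 : Set (Model X Y))
    (D : ClassDist X Y 𝓜₀) : ℝ :=
  ⨅ p : ProbabilityMeasure X,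
    ⨆ M ∈ {M ∈ 𝓜 | randAvgHell p M D ≤ ε ^ 2}, avgGap p M

/-- The randomized offset PAC DEC. -/
def decOpacRand (γ : ℝ) {𝓜₀ : Set (Model X Y)} (𝓜 : Set (Model X Y))
    (D : ClassDist X Y 𝓜₀) : ℝ :=
  ⨅ p : ProbabilityMeasure X, ⨅ q : ProbabilityMeasure X,
    ⨆ M ∈ 𝓜, (avgGap p M - γ * randAvgHell q M D)

/-- The Bayesian offset regret DEC (sup over priors of the inf over decision distributions). -/
def bayesDecO (γ : ℝ) (𝓜 : Set (Model X Y)) (Mbar : Model X Y) : ℝ :=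
  sSup {x : ℝ | ∃ D : ClassDist X Y 𝓜,
    x = ⨅ p : ProbabilityMeasure X,
          ∫ ω, (avgGap p (D.m ω) - γ * avgHell p (D.m ω) Mbar) ∂D.ν}

/-- The Bayesian offset PAC DEC. -/
def bayesDecOpac (γ : ℝ) (𝓜 : Set (Model X Y)) (Mbar : Model X Y) : ℝ :=
  sSup {x : ℝ | ∃ D : ClassDist X Y 𝓜,
    x = ⨅ p : ProbabilityMeasure X, ⨅ q : ProbabilityMeasure X,
          ∫ ω, (avgGap p (D.m ω) - γ * avgHell q (D.m ω) Mbar) ∂D.ν}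

/-- Histories of interaction. -/
abbrev Hist (X Y : Type) (n : ℕ) := Fin n → X × ℝ × Y

/-- Prefix of a history. -/
def hPrefix {n : ℕ} (h : Hist X Y n) (t : ℕ) (ht : t ≤ n) : Hist X Y t :=
  fun i => h (Fin.castLE ht i)

/-- Law of the interaction history under model `M` and selection rule `sel`. -/
def histLaw (M : Model X Y) (sel : (n : ℕ) → Hist X Y n → Measure X) :
    (n : ℕ) → Measure (Hist X Y n)
  | 0 => Measure.dirac (fun i => i.elim0)
  | n + 1 =>
    (histLaw M sel n).bind fun h =>
      (sel n h).bind fun x =>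
        (M.k x).bind fun ry => Measure.dirac (Fin.snoc h (x, ry))

/-- A regret-minimization algorithm: a sequence of probability kernels from histories
to decisions. -/
structure RegAlg (X Y : Type) [MeasurableSpace X] [MeasurableSpace Y] where
  sel : (n : ℕ) → Hist X Y n → Measure X
  prob : ∀ n h, IsProbabilityMeasure (sel n h)
  meas : ∀ n, Measurable (sel n)

instance [Nonempty X] : Nonempty (RegAlg X Y) :=
  ⟨⟨fun _ _ => Measure.dirac (Classical.arbitrary X),
    fun _ _ => by infer_instance, fun _ => measurable_const⟩⟩

/-- Expected cumulative regret of algorithm `A` under model `M` over `T` rounds. -/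
def expRegret (M : Model X Y) (A : RegAlg X Y) (T : ℕ) : ℝ :=
  ∑ t ∈ Finset.range T, ∫ h, (∫ x, gap M x ∂(A.sel t h)) ∂(histLaw M A.sel t)

/-- A PAC algorithm with `T` rounds of interaction: exploration kernels together with an
output kernel. -/
structure PacAlg (X Y : Type) [MeasurableSpace X] [MeasurableSpace Y] (T : ℕ) where
  explore : (n : ℕ) → Hist X Y n → Measure X
  explore_prob : ∀ n h, IsProbabilityMeasure (explore n h)
  explore_meas : ∀ n, Measurable (explore n)
  out : Hist X Y T → Measure X
  out_prob : ∀ h, IsProbabilityMeasure (out h)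
  out_meas : Measurable out

/-- Risk of the PAC algorithm conditionally on the realized history. -/
def condRisk (M : Model X Y) {T : ℕ} (A : PacAlg X Y T) (h : Hist X Y T) : ℝ :=
  ∫ x, gap M x ∂(A.out h)

/-- Expected risk of PAC algorithm `A` under model `M`. -/
def pacRisk (M : Model X Y) {T : ℕ} (A : PacAlg X Y T) : ℝ :=
  ∫ h, condRisk M A h ∂(histLaw M A.explore T)

/-- The density-ratio bound `V(𝓜)`. -/
def Vval (𝓜 : Set (Model X Y)) : ℝ≥0∞ :=
  max (ENNReal.ofReal (Real.exp 1))
    (⨆ M ∈ 𝓜, ⨆ M' ∈ 𝓜, ⨆ x : X,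
      ⨆ A ∈ {A : Set (ℝ × Y) | MeasurableSet A}, M.k x A / M'.k x A)

/-- `C(T) = log (min (T, V(𝓜)))`. -/
def Cval (𝓜 : Set (Model X Y)) (T : ℕ) : ℝ :=
  Real.log ((min (T : ℝ≥0∞) (Vval 𝓜)).toReal)

/-- An online estimation oracle for the class `𝓜` with estimation-error bound `Est`. -/
structure EstOracle (X Y : Type) [MeasurableSpace X] [MeasurableSpace Y]
    (𝓜 : Set (Model X Y)) (Est : ℝ → ℝ → ℝ) where
  est : (T' : ℕ) → (δ' : ℝ) → (n : ℕ) → Hist X Y n → Model X Y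
  est_mem : ∀ T' δ' n h, est T' δ' n h ∈ convHull 𝓜
  guarantee : ∀ (T' : ℕ) (δ' : ℝ), 0 < δ' → ∀ Mstar ∈ 𝓜, ∀ A : RegAlg X Y,
    ((histLaw Mstar A.sel T')
      {h : Hist X Y T' |
        (∑ t : Fin T',
          ∫ x, sqHellinger (Mstar.k x)
              ((est T' δ' (t : ℕ) (hPrefix h (t : ℕ) t.2.le)).k x)
            ∂(A.sel (t : ℕ) (hPrefix h (t : ℕ) t.2.le)))
          ≤ Est (T' : ℝ) δ'}).toReal ≥ 1 - δ'

/-- A constrained online estimation oracle for the class `𝓜`. -/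
structure CEstOracle (X Y : Type) [MeasurableSpace X] [MeasurableSpace Y]
    (𝓜 : Set (Model X Y)) (Est : ℝ → ℝ → ℝ) where
  est : (𝓜' : Set (Model X Y)) → (T' : ℕ) → (δ' : ℝ) → (n : ℕ) → Hist X Y n → Model X Y
  est_mem : ∀ 𝓜', 𝓜' ⊆ 𝓜 → ∀ T' δ' n h, est 𝓜' T' δ' n h ∈ convHull 𝓜'
  guarantee : ∀ 𝓜', 𝓜' ⊆ 𝓜 → ∀ (T' : ℕ) (δ' : ℝ), 0 < δ' → ∀ Mstar ∈ 𝓜',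
    ∀ A : RegAlg X Y,
    ((histLaw Mstar A.sel T')
      {h : Hist X Y T' |
        (∑ t : Fin T',
          ∫ x, sqHellinger (Mstar.k x)
              ((est 𝓜' T' δ' (t : ℕ) (hPrefix h (t : ℕ) t.2.le)).k x)
            ∂(A.sel (t : ℕ) (hPrefix h (t : ℕ) t.2.le)))
          ≤ Est (T' : ℝ) δ'}).toReal ≥ 1 - δ'

/-- A packaged (decision space, observation space) pair. -/
structure MSpace where
  (X : Type)
  (Y : Type)
  [iX : MeasurableSpace X]
  [iY : MeasurableSpace Y]
  [nX : Nonempty X]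

attribute [instance] MSpace.iX MSpace.iY MSpace.nX

end

lemma sqHellinger_self {Z : Type} [MeasurableSpace Z] (P : Measure Z) : sqHellinger P P = 0 := by
  simp [sqHellinger]

lemma sqHellinger_nonneg {Z : Type} [MeasurableSpace Z] (P Q : Measure Z) :
    0 ≤ sqHellinger P Q :=
  integral_nonneg fun _ => sq_nonneg _

lemma sqHellinger_comm {Z : Type} [MeasurableSpace Z] (P Q : Measure Z) :
    sqHellinger P Q = sqHellinger Q P := by
  unfold sqHellinger
  rw [add_comm P Q]
  congr 1
  ext z
  ring

lemma sq_sqrt_sub_sqrt_le_abs {a b : ℝ} (ha : 0 ≤ a) (hb : 0 ≤ b) :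
    (√a - √b) ^ 2 ≤ |a - b| := by
  have h : a - b = (√a - √b) * (√a + √b) := by
    ring_nf; rw [Real.sq_sqrt ha, Real.sq_sqrt hb]
  have h₁ : |√a - √b| ≤ √a + √b := by
    rw [abs_le]; constructor <;> linarith [Real.sqrt_nonneg a, Real.sqrt_nonneg b]
  rw [h, abs_mul, abs_of_nonneg (a := √a + √b) (by positivity), ← sq_abs, sq]
  gcongr

lemma linear_le_sq_sqrt_sub_sqrt {a b : ℝ} (ha : 0 ≤ a) (hb : 0 ≤ b) :
    a / 4 - b / 3 ≤ (√a - √b) ^ 2 := by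
  nlinarith [sq_nonneg (3 * √a - 4 * √b), Real.sq_sqrt ha, Real.sq_sqrt hb]

lemma integrable_sq_sqrt_rnDeriv_sub {Z : Type} [MeasurableSpace Z] (P Q ν : Measure Z)
    [IsFiniteMeasure P] [IsFiniteMeasure Q] :
    Integrable (fun z => (√(P.rnDeriv ν z).toReal - √(Q.rnDeriv ν z).toReal) ^ 2) ν := by
  have hP : Integrable (fun z => (P.rnDeriv ν z).toReal) ν := Measure.integrable_toReal_rnDeriv
  have hQ : Integrable (fun z => (Q.rnDeriv ν z).toReal) ν := Measure.integrable_toReal_rnDeriv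
  refine (hP.sub hQ).abs.mono' (by fun_prop) (ae_of_all _ fun z => ?_)
  rw [Real.norm_of_nonneg (sq_nonneg _)]
  exact sq_sqrt_sub_sqrt_le_abs ENNReal.toReal_nonneg ENNReal.toReal_nonneg

lemma measureReal_sub_le_sqHellinger {Z : Type} [MeasurableSpace Z] (P Q : Measure Z)
    [IsFiniteMeasure P] [IsFiniteMeasure Q] (A : Set Z) :
    P.real A / 4 - Q.real A / 3 ≤ sqHellinger P Q := by
  have hP : Integrable (fun z => (P.rnDeriv (P + Q) z).toReal) (P + Q) :=
    Measure.integrable_toReal_rnDeriv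
  have hQ : Integrable (fun z => (Q.rnDeriv (P + Q) z).toReal) (P + Q) :=
    Measure.integrable_toReal_rnDeriv
  have hPac : P ≪ P + Q := Measure.AbsolutelyContinuous.rfl.add_right Q
  have hQac : Q ≪ P + Q := by
    rw [add_comm]; exact Measure.AbsolutelyContinuous.rfl.add_right P
  have hI := integrable_sq_sqrt_rnDeriv_sub P Q (P + Q)
  calc P.real A / 4 - Q.real A / 3
      = ∫ z in A, ((P.rnDeriv (P + Q) z).toReal / 4 - (Q.rnDeriv (P + Q) z).toReal / 3)
          ∂(P + Q) := by
        rw [integral_sub (hP.integrableOn.div_const _) (hQ.integrableOn.div_const _),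
          integral_div, integral_div, Measure.setIntegral_toReal_rnDeriv hPac,
          Measure.setIntegral_toReal_rnDeriv hQac]
    _ ≤ ∫ z in A, (√(P.rnDeriv (P + Q) z).toReal - √(Q.rnDeriv (P + Q) z).toReal) ^ 2
          ∂(P + Q) :=
        integral_mono ((hP.div_const _).sub (hQ.div_const _)).integrableOn hI.integrableOn
          fun z => linear_le_sq_sqrt_sub_sqrt ENNReal.toReal_nonneg ENNReal.toReal_nonneg
    _ ≤ sqHellinger P Q := setIntegral_le_integral hI (ae_of_all _ fun _ => sq_nonneg _)

lemma sqHellinger_add_left_le {Z : Type} [MeasurableSpace Z] (R P Q : Measure Z)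
    [IsFiniteMeasure R] [IsFiniteMeasure P] [IsFiniteMeasure Q] :
    sqHellinger (R + P) (R + Q) ≤ P.real Set.univ + Q.real Set.univ := by
  unfold sqHellinger
  set ν := (R + P) + (R + Q) with hν
  have hP : Integrable (fun z => (P.rnDeriv ν z).toReal) ν := Measure.integrable_toReal_rnDeriv
  have hQ : Integrable (fun z => (Q.rnDeriv ν z).toReal) ν := Measure.integrable_toReal_rnDeriv
  have hPac : P ≪ ν := Measure.AbsolutelyContinuous.mk fun s _ h => by
    simp only [hν, Measure.add_apply, add_eq_zero] at h; exact h.1.2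
  have hQac : Q ≪ ν := Measure.AbsolutelyContinuous.mk fun s _ h => by
    simp only [hν, Measure.add_apply, add_eq_zero] at h; exact h.2.2
  rw [← Measure.integral_toReal_rnDeriv hPac, ← Measure.integral_toReal_rnDeriv hQac,
    ← integral_add hP hQ]
  refine integral_mono_ae (integrable_sq_sqrt_rnDeriv_sub _ _ ν) (hP.add hQ) ?_
  filter_upwards [Measure.rnDeriv_add R P ν, Measure.rnDeriv_add R Q ν, R.rnDeriv_lt_top ν,
    P.rnDeriv_lt_top ν, Q.rnDeriv_lt_top ν] with z h₁ h₂ hr hp hq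
  refine (sq_sqrt_sub_sqrt_le_abs ENNReal.toReal_nonneg ENNReal.toReal_nonneg).trans ?_
  rw [h₁, h₂, Pi.add_apply, Pi.add_apply, ENNReal.toReal_add hr.ne hp.ne,
    ENNReal.toReal_add hr.ne hq.ne, abs_le]
  have := (P.rnDeriv ν z).toReal_nonneg
  have := (Q.rnDeriv ν z).toReal_nonneg
  constructor <;> linarith

lemma sqHellinger_le_two {Z : Type} [MeasurableSpace Z] (P Q : Measure Z)
    [IsProbabilityMeasure P] [IsProbabilityMeasure Q] : sqHellinger P Q ≤ 2 := by
  have h := sqHellinger_add_left_le 0 P Q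
  simp only [zero_add, probReal_univ] at h
  linarith

noncomputable section

variable {X Y : Type} [MeasurableSpace X] [MeasurableSpace Y]

attribute [instance] Model.markov

lemma ae_reward_mem_Icc (M : Model X Y) (x : X) :
    ∀ᵐ ry ∂(M.k x), ry.1 ∈ Set.Icc (0 : ℝ) 1 :=
  M.reward01 x

lemma fm_nonneg (M : Model X Y) (x : X) : 0 ≤ fm M x := by
  refine integral_nonneg_of_ae ?_
  filter_upwards [ae_reward_mem_Icc M x] with ry h using h.1

lemma fm_le_one (M : Model X Y) (x : X) : fm M x ≤ 1 := by
  have hi : Integrable (fun ry : ℝ × Y => ry.1) (M.k x) :=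
    Integrable.of_mem_Icc 0 1 (by fun_prop) (ae_reward_mem_Icc M x)
  calc fm M x ≤ ∫ _, (1 : ℝ) ∂(M.k x) := by
        refine integral_mono_ae hi (integrable_const _) ?_
        filter_upwards [ae_reward_mem_Icc M x] with ry h using h.2
    _ = 1 := by simp

lemma gap_nonneg (M : Model X Y) (x : X) : 0 ≤ gap M x :=
  sub_nonneg.2 (M.opt_max x)

lemma gap_le_one (M : Model X Y) (x : X) : gap M x ≤ 1 := by
  unfold gap
  linarith [fm_le_one M M.opt, fm_nonneg M x]

lemma avgGap_nonneg (p : ProbabilityMeasure X) (M : Model X Y) : 0 ≤ avgGap p M :=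
  integral_nonneg (gap_nonneg M)

lemma avgGap_le_one (p : ProbabilityMeasure X) (M : Model X Y) : avgGap p M ≤ 1 := by
  calc avgGap p M ≤ ∫ _, (1 : ℝ) ∂(p : Measure X) :=
        integral_mono_of_nonneg (ae_of_all _ (gap_nonneg M)) (integrable_const _)
          (ae_of_all _ (gap_le_one M))
    _ = 1 := by simp

lemma avgHell_nonneg (p : ProbabilityMeasure X) (M Mbar : Model X Y) : 0 ≤ avgHell p M Mbar :=
  integral_nonneg fun _ => sqHellinger_nonneg _ _

lemma avgHell_self (p : ProbabilityMeasure X) (M : Model X Y) : avgHell p M M = 0 := by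
  simp [avgHell, sqHellinger_self]

lemma decC_le_of_forall {ε B : ℝ} (hB : 0 ≤ B) {𝓜 : Set (Model X Y)} {Mbar : Model X Y}
    (p : ProbabilityMeasure X)
    (h : ∀ M ∈ 𝓜, avgHell p M Mbar ≤ ε ^ 2 → avgGap p M ≤ B) : decC ε 𝓜 Mbar ≤ B := by
  refine (ciInf_le ⟨0, ?_⟩ p).trans ?_
  · rintro _ ⟨q, rfl⟩
    exact Real.iSup_nonneg fun M => Real.iSup_nonneg fun _ => avgGap_nonneg q M
  · exact Real.iSup_le (fun M => Real.iSup_le (fun hM => h M hM.1 hM.2) hB) hB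

lemma le_decO_of_forall [Nonempty X] {γ c : ℝ} (hγ : 0 ≤ γ) {𝓜 : Set (Model X Y)}
    {Mbar : Model X Y}
    (h : ∀ p : ProbabilityMeasure X, ∃ M ∈ 𝓜, c ≤ avgGap p M - γ * avgHell p M Mbar) :
    c ≤ decO γ 𝓜 Mbar := by
  have : Nonempty (ProbabilityMeasure X) :=
    ⟨⟨Measure.dirac (Classical.arbitrary X), inferInstance⟩⟩
  refine le_ciInf fun p => ?_
  obtain ⟨M, hM, hc⟩ := h p
  have hle : ∀ M, avgGap p M - γ * avgHell p M Mbar ≤ 1 := fun M => by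
    linarith [avgGap_le_one p M, mul_nonneg hγ (avgHell_nonneg p M Mbar)]
  refine hc.trans (le_ciSup_of_le ⟨1, ?_⟩ M (le_ciSup_of_le ⟨1, ?_⟩ hM le_rfl))
  · rintro _ ⟨M', rfl⟩
    exact Real.iSup_le (fun _ => hle M') zero_le_one
  · rintro _ ⟨_, rfl⟩
    exact hle M

/-- Play `b` with probability `q` and `a` otherwise. -/
def twoPoint (a b : X) (q : ℝ≥0) (hq : q ≤ 1) : ProbabilityMeasure X :=
  ⟨(1 - q) • Measure.dirac a + q • Measure.dirac b, ⟨by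
    simp only [Measure.add_apply, Measure.smul_apply, measure_univ, ENNReal.smul_def,
      smul_eq_mul, mul_one]
    exact_mod_cast tsub_add_cancel_of_le hq⟩⟩

lemma integral_twoPoint [MeasurableSingletonClass X] (a b : X) (q : ℝ≥0) (hq : q ≤ 1)
    (f : X → ℝ) :
    ∫ x, f x ∂(twoPoint a b q hq : Measure X) = (1 - q) * f a + q * f b := by
  have hi : ∀ c, Integrable f (Measure.dirac c) := fun c => integrable_dirac (by simp)
  have h : (twoPoint a b q hq : Measure X) = (1 - q) • Measure.dirac a + q • Measure.dirac b := rfl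
  rw [h, integral_add_measure (hi a).smul_measure_nnreal (hi b).smul_measure_nnreal,
    integral_smul_nnreal_measure, integral_smul_nnreal_measure, integral_dirac, integral_dirac,
    NNReal.smul_def, NNReal.smul_def, NNReal.coe_sub hq]
  simp

/-- Expected reward of decision `x` in the `i`-th model of the separating class: decision `0` is
safe, decision `1` only gathers information, and decision `i ≥ 2` is optimal in model `i`. -/
def armMean (i x : ℕ) : ℝ :=
  if x = 0 then 1 / 2 else if x = 1 then 0 else if x = i then 1 else 0

/-- Outcome distributions of the `i`-th model of the separating class: rewards are deterministic,
and decision `1` reveals `i` with probability `α`. -/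
def armKernel (α : ℝ≥0) (i : ℕ) : Kernel ℕ (ℝ × ℕ) :=
  Kernel.ofFunOfCountable fun x =>
    if x = 1 then (1 - α) • Measure.dirac (0, 0) + α • Measure.dirac (0, i)
    else Measure.dirac (armMean i x, 0)

lemma armKernel_one (α : ℝ≥0) (i : ℕ) :
    armKernel α i 1 = (1 - α) • Measure.dirac (0, 0) + α • Measure.dirac (0, i) :=
  rfl

lemma armKernel_of_ne_one (α : ℝ≥0) (i : ℕ) {x : ℕ} (hx : x ≠ 1) :
    armKernel α i x = Measure.dirac (armMean i x, 0) :=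
  if_neg hx

lemma armKernel_one_eq_twoPoint {α : ℝ≥0} (hα : α ≤ 1) (i : ℕ) :
    armKernel α i 1 = (twoPoint ((0 : ℝ), 0) (0, i) α hα : Measure (ℝ × ℕ)) :=
  rfl

lemma armMean_mem_Icc (i x : ℕ) : armMean i x ∈ Set.Icc (0 : ℝ) 1 := by
  unfold armMean
  split_ifs <;> norm_num

lemma isMarkovKernel_armKernel {α : ℝ≥0} (hα : α ≤ 1) (i : ℕ) :
    IsMarkovKernel (armKernel α i) := by
  refine ⟨fun x => ?_⟩
  by_cases hx : x = 1
  · subst hx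
    rw [armKernel_one_eq_twoPoint hα]
    infer_instance
  · rw [armKernel_of_ne_one α i hx]
    infer_instance

lemma integral_armKernel {α : ℝ≥0} (hα : α ≤ 1) (i x : ℕ) :
    ∫ ry, ry.1 ∂(armKernel α i x) = armMean i x := by
  by_cases hx : x = 1
  · subst hx
    rw [armKernel_one_eq_twoPoint hα, integral_twoPoint]
    simp [armMean]
  · rw [armKernel_of_ne_one α i hx, integral_dirac]

lemma ae_armKernel {α : ℝ≥0} (i x : ℕ) : ∀ᵐ ry ∂(armKernel α i x), ry.1 = armMean i x := by
  by_cases hx : x = 1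
  · subst hx
    rw [armKernel_one, ae_iff]
    simp [armMean]
  · rw [armKernel_of_ne_one α i hx, ae_dirac_eq]
    rfl

/-- The `i`-th model of the separating class. -/
def armModel (α : ℝ≥0) (hα : α ≤ 1) (i : ℕ) : Model ℕ ℕ where
  k := armKernel α i
  markov := isMarkovKernel_armKernel hα i
  reward01 x := by
    have h : ∀ᵐ ry ∂(armKernel α i x), ry ∈ {ry : ℝ × ℕ | ry.1 ∈ Set.Icc (0 : ℝ) 1} := by
      filter_upwards [ae_armKernel i x] with ry h
      exact h ▸ armMean_mem_Icc i x
    exact h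
  opt := if 2 ≤ i then i else 0
  opt_max x := by
    simp only [integral_armKernel hα]
    unfold armMean
    split_ifs <;> first | omega | norm_num

lemma fm_armModel {α : ℝ≥0} (hα : α ≤ 1) (i x : ℕ) : fm (armModel α hα i) x = armMean i x :=
  integral_armKernel hα i x

lemma armKernel_reward_eq_one {α : ℝ≥0} (hα : α ≤ 1) (i x : ℕ) :
    armKernel α i x (Prod.fst ⁻¹' {1}) = if 2 ≤ x ∧ x = i then 1 else 0 := by
  have := isMarkovKernel_armKernel hα i
  have h : armKernel α i x (Prod.fst ⁻¹' {1}) = armKernel α i x {_ry | armMean i x = 1} := by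
    refine measure_congr ?_
    filter_upwards [ae_armKernel i x] with ry hry
    exact congrArg (· = 1) hry
  rw [h]
  unfold armMean
  by_cases hx : 2 ≤ x ∧ x = i
  · obtain ⟨hx, rfl⟩ := hx
    have h₀ : x ≠ 0 := by omega
    have h₁ : x ≠ 1 := by omega
    simp [h₀, h₁, hx]
  · rw [if_neg hx]
    split_ifs <;> first | omega | norm_num

/-- The properties shared by all mixtures of the models `armModel α hα i`. -/
structure IsArmMixture (α : ℝ≥0) (M : Model ℕ ℕ) : Prop where
  safe : M.k 0 (Prod.fst ⁻¹' {1 / 2})ᶜ = 0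
  zero_or_one : ∀ x ≠ 0, M.k x (Prod.fst ⁻¹' {0, 1})ᶜ = 0
  reveal_reward : M.k 1 (Prod.fst ⁻¹' {1}) = 0
  reveal_obs : ∀ x, 2 ≤ x → M.k 1 (Prod.snd ⁻¹' {x}) = α * M.k x (Prod.fst ⁻¹' {1})
  add_le_one : ∀ x y, x ≠ y → M.k x (Prod.fst ⁻¹' {1}) + M.k y (Prod.fst ⁻¹' {1}) ≤ 1

lemma isArmMixture_armModel {α : ℝ≥0} (hα : α ≤ 1) (i : ℕ) :
    IsArmMixture α (armModel α hα i) where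
  safe := by
    have h : ∀ᵐ ry ∂(armKernel α i 0), ry.1 = 1 / 2 := ae_armKernel i 0
    exact h
  zero_or_one x hx := by
    have h : ∀ᵐ ry ∂(armKernel α i x), ry.1 = 0 ∨ ry.1 = 1 := by
      filter_upwards [ae_armKernel i x] with ry h
      rw [h]
      unfold armMean
      split_ifs <;> first | contradiction | simp
    exact h
  reveal_reward := by
    change armKernel α i 1 _ = 0
    simp [armKernel_reward_eq_one hα]
  reveal_obs x hx := by
    change armKernel α i 1 _ = α * armKernel α i x _
    rw [armKernel_reward_eq_one hα, armKernel_one]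
    have hx₀ : x ≠ 0 := by omega
    have hm : MeasurableSet (Prod.snd ⁻¹' {x} : Set (ℝ × ℕ)) :=
      measurable_snd (measurableSet_singleton x)
    rw [Measure.add_apply, Measure.smul_apply, Measure.smul_apply, Measure.dirac_apply' _ hm,
      Measure.dirac_apply' _ hm]
    by_cases hxi : x = i
    · subst hxi
      simp [hx, hx₀.symm, Set.indicator, ENNReal.smul_def]
    · simp [hxi, Ne.symm hxi, hx₀.symm, Set.indicator]
  add_le_one x y hxy := by
    change armKernel α i x _ + armKernel α i y _ ≤ 1
    rw [armKernel_reward_eq_one hα, armKernel_reward_eq_one hα]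
    split_ifs <;> first | omega | norm_num

/-- The separating class. -/
def armClass (α : ℝ≥0) (hα : α ≤ 1) : Set (Model ℕ ℕ) :=
  Set.range (armModel α hα)

lemma isArmMixture_of_mem_convHull {α : ℝ≥0} {hα : α ≤ 1} {M : Model ℕ ℕ}
    (hM : M ∈ convHull (armClass α hα)) : IsArmMixture α M := by
  obtain ⟨D, hD⟩ := hM
  have := D.prob
  have hm : ∀ ω, IsArmMixture α (D.m ω) := fun ω => by
    obtain ⟨i, hi⟩ := D.mem ω
    exact hi ▸ isArmMixture_armModel hα i
  have hfst : ∀ s : Set ℝ, MeasurableSet s →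
      MeasurableSet (Prod.fst ⁻¹' s : Set (ℝ × ℕ)) := fun s hs => measurable_fst hs
  have h₁ := hfst {1} (measurableSet_singleton 1)
  refine ⟨?_, fun x hx => ?_, ?_, fun x hx => ?_, fun x y hxy => ?_⟩
  · rw [hD _ _ (hfst _ (measurableSet_singleton _)).compl]
    simp only [fun ω => (hm ω).safe, lintegral_zero]
  · rw [hD _ _ (hfst _ (Set.toFinite _).measurableSet).compl]
    simp [fun ω => (hm ω).zero_or_one x hx]
  · rw [hD _ _ h₁]
    simp [fun ω => (hm ω).reveal_reward]
  · rw [hD _ _ h₁, hD _ _ (measurable_snd (measurableSet_singleton x)),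
      ← lintegral_const_mul _ (D.meas x _ h₁)]
    simp_rw [fun ω => (hm ω).reveal_obs x hx]
  · rw [hD _ _ h₁, hD _ _ h₁, ← lintegral_add_left (D.meas x _ h₁)]
    calc _ ≤ ∫⁻ _, 1 ∂D.ν := lintegral_mono fun ω => (hm ω).add_le_one x y hxy
      _ = 1 := by simp

namespace IsArmMixture

variable {α : ℝ≥0} {M : Model ℕ ℕ}

lemma fm_zero (h : IsArmMixture α M) : fm M 0 = 1 / 2 := by
  have hae : ∀ᵐ ry ∂(M.k 0), ry.1 = 1 / 2 := h.safe
  rw [fm, integral_congr_ae hae]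
  simp

lemma fm_of_ne_zero (h : IsArmMixture α M) {x : ℕ} (hx : x ≠ 0) :
    fm M x = (M.k x).real (Prod.fst ⁻¹' {1}) := by
  have hae : ∀ᵐ ry ∂(M.k x), ry.1 = 0 ∨ ry.1 = 1 := h.zero_or_one x hx
  rw [fm, ← integral_indicator_one (measurable_fst (measurableSet_singleton (1 : ℝ)))]
  refine integral_congr_ae ?_
  filter_upwards [hae] with ry hry
  rcases hry with h | h <;> simp [h, Set.indicator]

lemma fm_one (h : IsArmMixture α M) : fm M 1 = 0 := by
  rw [h.fm_of_ne_zero one_ne_zero, Measure.real, h.reveal_reward, ENNReal.toReal_zero]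

lemma real_reveal_obs (h : IsArmMixture α M) {x : ℕ} (hx : 2 ≤ x) :
    (M.k 1).real (Prod.snd ⁻¹' {x}) = α * fm M x := by
  rw [h.fm_of_ne_zero (by omega), Measure.real, h.reveal_obs x hx, ENNReal.toReal_mul,
    Measure.real, ENNReal.coe_toReal]

lemma fm_add_fm_le_one (h : IsArmMixture α M) {x y : ℕ} (hx : x ≠ 0) (hy : y ≠ 0)
    (hxy : x ≠ y) : fm M x + fm M y ≤ 1 := by
  rw [h.fm_of_ne_zero hx, h.fm_of_ne_zero hy, Measure.real, Measure.real,
    ← ENNReal.toReal_add (measure_ne_top _ _) (measure_ne_top _ _)]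
  exact ENNReal.toReal_le_of_le_ofReal zero_le_one (by simpa using h.add_le_one x y hxy)

end IsArmMixture

/-- The information-gathering decision separates a model from a mixture unless some decision is
optimal for both. -/
lemma exists_forall_opt_or_le_sqHellinger {α : ℝ≥0} (hα : α ≤ 1) {Mbar : Model ℕ ℕ}
    (hMbar : IsArmMixture α Mbar) :
    ∃ a, ∀ M ∈ armClass α hα ∪ {Mbar},
      (∀ x, fm M x ≤ fm M a) ∨ α / 12 ≤ sqHellinger (M.k 1) (Mbar.k 1) := by
  have hα₀ : (0 : ℝ) ≤ α := α.2
  by_cases hbar : ∃ a, 2 ≤ a ∧ 1 / 2 < fm Mbar a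
  · obtain ⟨a, ha, hfa⟩ := hbar
    refine ⟨a, ?_⟩
    rintro M (⟨i, rfl⟩ | rfl)
    · by_cases hia : i = a
      · subst hia
        refine Or.inl fun x => ?_
        rw [fm_armModel, fm_armModel]
        unfold armMean
        split_ifs <;> first | omega | norm_num
      · right
        have h := measureReal_sub_le_sqHellinger (Mbar.k 1) ((armModel α hα i).k 1)
          (Prod.snd ⁻¹' {a})
        have h₀ : fm (armModel α hα i) a = 0 := by
          rw [fm_armModel]
          unfold armMean
          split_ifs <;> first | omega | rfl
        rw [hMbar.real_reveal_obs ha, (isArmMixture_armModel hα i).real_reveal_obs ha, h₀,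
          sqHellinger_comm] at h
        nlinarith
    · refine Or.inl fun x => ?_
      rcases eq_or_ne x 0 with rfl | hx
      · rw [hMbar.fm_zero]
        exact hfa.le
      · rcases eq_or_ne x a with rfl | hxa
        · exact le_rfl
        · linarith [hMbar.fm_add_fm_le_one hx (by omega) hxa]
  · push Not at hbar
    refine ⟨0, ?_⟩
    rintro M (⟨i, rfl⟩ | rfl)
    · by_cases hi : 2 ≤ i
      · right
        have h := measureReal_sub_le_sqHellinger ((armModel α hα i).k 1) (Mbar.k 1)
          (Prod.snd ⁻¹' {i})
        have h₁ : fm (armModel α hα i) i = 1 := by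
          rw [fm_armModel]
          unfold armMean
          split_ifs <;> first | omega | rfl
        rw [hMbar.real_reveal_obs hi, (isArmMixture_armModel hα i).real_reveal_obs hi, h₁] at h
        nlinarith [hbar i hi]
      · refine Or.inl fun x => ?_
        rw [fm_armModel, fm_armModel]
        unfold armMean
        split_ifs <;> first | omega | norm_num
    · refine Or.inl fun x => ?_
      rw [hMbar.fm_zero]
      obtain rfl | rfl | hx : x = 0 ∨ x = 1 ∨ 2 ≤ x := by omega
      · rw [hMbar.fm_zero]
      · rw [hMbar.fm_one]; norm_num
      · exact hbar x hx

lemma decC_armClass_le {α : ℝ≥0} (hα₀ : 0 < α) (hα : α ≤ 1) {Mbar : Model ℕ ℕ}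
    (hMbar : IsArmMixture α Mbar) {ε : ℝ} (hε : 0 < ε) :
    decC ε (armClass α hα ∪ {Mbar}) Mbar ≤ 13 * ε ^ 2 / α := by
  have hα₀' : (0 : ℝ) < α := hα₀
  have hB : 0 < 13 * ε ^ 2 / α := by positivity
  by_cases hq : 13 * ε ^ 2 / α ≤ 1
  · obtain ⟨a, ha⟩ := exists_forall_opt_or_le_sqHellinger hα hMbar
    let q : ℝ≥0 := ⟨13 * ε ^ 2 / α, hB.le⟩
    have hq' : (q : ℝ) = 13 * ε ^ 2 / α := rfl
    have hq₁ : q ≤ 1 := hq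
    refine decC_le_of_forall hB.le (twoPoint a 1 q hq₁) fun M hM hMε => ?_
    rw [avgHell, integral_twoPoint] at hMε
    rw [avgGap, integral_twoPoint]
    rcases ha M hM with h | h
    · have hgap : gap M a = 0 := le_antisymm (sub_nonpos.2 (h M.opt)) (gap_nonneg M a)
      rw [hgap, hq']
      nlinarith [gap_le_one M 1]
    · have h₁ : 0 ≤ (1 - q : ℝ) * sqHellinger (M.k a) (Mbar.k a) :=
        mul_nonneg (by rw [hq']; linarith) (sqHellinger_nonneg _ _)
      have h₂ : (q : ℝ) * (α / 12) ≤ q * sqHellinger (M.k 1) (Mbar.k 1) :=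
        mul_le_mul_of_nonneg_left h q.2
      have h₃ : (q : ℝ) * (α / 12) = 13 / 12 * ε ^ 2 := by
        rw [hq']
        field_simp
      nlinarith [pow_pos hε 2]
  · exact decC_le_of_forall hB.le ⟨Measure.dirac 0, inferInstance⟩ fun M _ _ =>
      (avgGap_le_one _ M).trans (not_le.1 hq).le

lemma sqHellinger_armKernel_one_le {α : ℝ≥0} (i j : ℕ) :
    sqHellinger (armKernel α i 1) (armKernel α j 1) ≤ 2 * α := by
  refine (sqHellinger_add_left_le _ _ _).trans_eq ?_
  simp [two_mul, measureReal_nnreal_smul_apply]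

lemma exists_measureReal_singleton_le (p : Measure ℕ) [IsFiniteMeasure p] {δ : ℝ} (hδ : 0 < δ)
    (n : ℕ) : ∃ i, n ≤ i ∧ p.real {i} ≤ δ := by
  have hsum : ∑' i, p {i} ≠ ∞ :=
    ((tsum_measure_le_measure_univ (fun i => (measurableSet_singleton i).nullMeasurableSet)
      fun i j hij => (Set.disjoint_singleton.2 hij).aedisjoint).trans_lt
        (measure_lt_top p _)).ne
  have h := ENNReal.tendsto_atTop_zero_of_tsum_ne_top hsum
  obtain ⟨i, hi, hin⟩ := ((h.eventually (eventually_le_nhds (ENNReal.ofReal_pos.2 hδ))).and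
    (Filter.eventually_ge_atTop n)).exists
  exact ⟨i, hin, ENNReal.toReal_le_of_le_ofReal hδ.le hi⟩

lemma le_avgGap_sub_avgHell {α : ℝ≥0} (hα : α ≤ 1) {γ : ℝ} (hγ : 0 ≤ γ) {i : ℕ} (hi : 2 ≤ i)
    (p : ProbabilityMeasure ℕ) :
    1 / 2 - (1 / 2 + 2 * γ) * (p : Measure ℕ).real {i} - 2 * γ * α * (p : Measure ℕ).real {1} ≤
      avgGap p (armModel α hα i) - γ * avgHell p (armModel α hα i) (armModel α hα 0) := by
  have hind : ∀ j : ℕ, Integrable (({j} : Set ℕ).indicator (1 : ℕ → ℝ)) (p : Measure ℕ) :=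
    fun j => (integrable_const 1).indicator (measurableSet_singleton j)
  have hG : 1 / 2 - 1 / 2 * (p : Measure ℕ).real {i} ≤ avgGap p (armModel α hα i) := by
    have h : ∫ x, (1 / 2 - 1 / 2 * ({i} : Set ℕ).indicator (1 : ℕ → ℝ) x) ∂(p : Measure ℕ)
        = 1 / 2 - 1 / 2 * (p : Measure ℕ).real {i} := by
      rw [integral_sub (integrable_const _) ((hind i).const_mul _), integral_const_mul,
        integral_indicator_one (measurableSet_singleton i)]
      simp
    rw [← h]
    refine integral_mono ((integrable_const _).sub ((hind i).const_mul _))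
      (Integrable.of_mem_Icc 0 1 (Measurable.of_discrete).aemeasurable
        (ae_of_all _ fun x => ⟨gap_nonneg _ x, gap_le_one _ x⟩)) fun x => ?_
    have hopt : (armModel α hα i).opt = i := if_pos hi
    simp only [gap, hopt, fm_armModel, armMean, Set.indicator, Set.mem_singleton_iff,
      Pi.one_apply]
    split_ifs <;> first | omega | norm_num
  have hH : avgHell p (armModel α hα i) (armModel α hα 0)
      ≤ 2 * (p : Measure ℕ).real {i} + 2 * α * (p : Measure ℕ).real {1} := by
    rw [← integral_indicator_one (measurableSet_singleton i),
      ← integral_indicator_one (measurableSet_singleton 1), ← integral_const_mul,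
      ← integral_const_mul, ← integral_add ((hind i).const_mul _) ((hind 1).const_mul _)]
    refine integral_mono_of_nonneg (ae_of_all _ fun x => sqHellinger_nonneg _ _)
      (((hind i).const_mul _).add ((hind 1).const_mul _)) (ae_of_all _ fun x => ?_)
    change sqHellinger (armKernel α i x) (armKernel α 0 x) ≤ _
    have hα₀ : (0 : ℝ) ≤ α := α.2
    rcases eq_or_ne x 1 with rfl | hx
    · have h1 : ¬ (1 = i) := by omega
      simpa [Set.indicator, h1] using sqHellinger_armKernel_one_le i 0
    · rcases eq_or_ne x i with rfl | hxi
      · have := isMarkovKernel_armKernel hα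
        simpa [Set.indicator, hx] using sqHellinger_le_two (armKernel α x x) (armKernel α 0 x)
      · have h : armKernel α i x = armKernel α 0 x := by
          rw [armKernel_of_ne_one α i hx, armKernel_of_ne_one α 0 hx]
          simp +contextual [armMean, hxi]
        simp [h, sqHellinger_self, Set.indicator, hx, hxi]
  nlinarith [mul_le_mul_of_nonneg_left hH hγ]

lemma le_avgGap_armModel_zero {α : ℝ≥0} (hα : α ≤ 1) (p : ProbabilityMeasure ℕ) :
    1 / 2 * (p : Measure ℕ).real {1} ≤ avgGap p (armModel α hα 0) := by
  rw [← integral_indicator_one (measurableSet_singleton 1), ← integral_const_mul]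
  refine integral_mono (((integrable_const 1).indicator (measurableSet_singleton 1)).const_mul _)
    (Integrable.of_mem_Icc 0 1 (Measurable.of_discrete).aemeasurable
      (ae_of_all _ fun x => ⟨gap_nonneg _ x, gap_le_one _ x⟩)) fun x => ?_
  have hopt : (armModel α hα 0).opt = 0 := rfl
  simp only [gap, hopt, fm_armModel, armMean, Set.indicator, Set.mem_singleton_iff,
    Pi.one_apply]
  split_ifs <;> first | omega | norm_num

lemma le_decO_armClass {α : ℝ≥0} (hα : α ≤ 1) {γ : ℝ} (hγ : 1 ≤ γ)
    (hγα : γ * (α : ℝ) ^ 2 = 1) :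
    1 / 32 * α ≤ decO γ (armClass α hα) (armModel α hα 0) := by
  have hα₁ : (α : ℝ) ≤ 1 := hα
  have hα₀ : (0 : ℝ) ≤ α := α.2
  refine le_decO_of_forall (by linarith) fun p => ?_
  by_cases hp : (α : ℝ) / 16 ≤ (p : Measure ℕ).real {1}
  · refine ⟨armModel α hα 0, ⟨0, rfl⟩, ?_⟩
    rw [avgHell_self]
    linarith [le_avgGap_armModel_zero hα p]
  · obtain ⟨i, hi, hpi⟩ := exists_measureReal_singleton_le (p : Measure ℕ)
      (show 0 < 1 / (16 * γ) by positivity) 2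
    refine ⟨armModel α hα i, ⟨i, rfl⟩, le_trans ?_
      (le_avgGap_sub_avgHell hα (by linarith) hi p)⟩
    have h₁ : γ * (p : Measure ℕ).real {i} ≤ 1 / 16 := by
      calc _ ≤ γ * (1 / (16 * γ)) := by gcongr
        _ = 1 / 16 := by field_simp
    have h₂ : (p : Measure ℕ).real {i} ≤ 1 / 16 := by
      nlinarith [measureReal_nonneg (μ := (p : Measure ℕ)) (s := {i})]
    have h₃ : γ * α * (p : Measure ℕ).real {1} ≤ 1 / 16 := by
      calc _ ≤ γ * α * (α / 16) := by gcongr; exact (not_le.1 hp).le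
        _ = γ * (α : ℝ) ^ 2 / 16 := by ring
        _ = 1 / 16 := by rw [hγα]
    linarith

end

/-- a class separating the constrained and offset regret DEC. -/
theorem constrained_offset_counterexample :
    ∃ C c : ℝ, 0 < C ∧ 0 < c ∧
      ∀ γ : ℝ, 1 ≤ γ →
        ∃ (S : MSpace) (𝓜 : Set (Model S.X S.Y)),
          (∀ ε : ℝ, 0 < ε → ε < 1 →
            (⨆ Mbar ∈ convHull 𝓜, decC ε (𝓜 ∪ {Mbar}) Mbar) ≤ C * ε ^ 2 * Real.sqrt γ) ∧
          (∀ ε : ℝ, 0 < ε → ε ≤ 1 / Real.sqrt γ →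
            (⨆ Mbar ∈ convHull 𝓜, decC ε (𝓜 ∪ {Mbar}) Mbar) ≤ C * ε) ∧
          ∃ Mbar ∈ 𝓜, decO γ 𝓜 Mbar ≥ c / Real.sqrt γ := by
  refine ⟨13, 1 / 32, by norm_num, by norm_num, fun γ hγ => ?_⟩
  have hs : 1 ≤ √γ := Real.one_le_sqrt.2 hγ
  let α : ℝ≥0 := ⟨1 / √γ, by positivity⟩
  have hαγ : (α : ℝ) = 1 / √γ := rfl
  have hα₀ : 0 < α := by
    rw [← NNReal.coe_pos, hαγ]
    positivity
  have hα : α ≤ 1 := by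
    rw [← NNReal.coe_le_coe, hαγ, NNReal.coe_one, div_le_one (by positivity)]
    exact hs
  have key : ∀ ε : ℝ, 0 < ε →
      (⨆ Mbar ∈ convHull (armClass α hα), decC ε (armClass α hα ∪ {Mbar}) Mbar) ≤
        13 * ε ^ 2 * √γ := fun ε hε =>
    Real.iSup_le (fun Mbar => Real.iSup_le (fun hMbar => by
      have h := decC_armClass_le hα₀ hα (isArmMixture_of_mem_convHull hMbar) hε
      rwa [hαγ, div_div_eq_mul_div, div_one] at h) (by positivity)) (by positivity)
  refine ⟨⟨ℕ, ℕ⟩, armClass α hα, fun ε hε _ => key ε hε, fun ε hε hε' => ?_,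
    armModel α hα 0, ⟨0, rfl⟩, ?_⟩
  · refine (key ε hε).trans ?_
    have h : ε * √γ ≤ 1 := by rwa [le_div_iff₀ (by positivity)] at hε'
    nlinarith
  · have h := le_decO_armClass hα hγ (by
      rw [hαγ, div_pow, Real.sq_sqrt (by positivity)]
      field_simp)
    rwa [hαγ, mul_one_div] at h
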